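/- Let D ⊂ ℝ × ℝ^{n−1} be open, and let g : D → ℝ be measurable with 0 ≤ g ≤ 1, ∂g/∂t ≤ 0 in the sense of distributions (i.e., ∫_D g ∂φ/∂t ≥ 0 for all nonnegative φ ∈ C_c^∞(D)). Suppose g = 1 a.e. on a box Q = (t₀−ε, t₀+ε) × B_ε(ω₀) ⊂ D. Then g = 1 a.e. on C = {(t,ω) ∈ D : |ω−ω₀| < ε, t < t₀+ε}, provided C is contained in D and for each ω with |ω−ω₀| < ε the slice {t : (t,ω) ∈ D} is an interval. -/

import Mathlib

open Real Set MeasureTheory Metric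

/-- The difference of two translates of a nonnegative smooth bump on the line is the derivative of
a nonnegative smooth function supported between the two bumps. -/
lemma exists_nonneg_primitive_sub_translate {ψ : ℝ → ℝ} (hψ : ContDiff ℝ (⊤ : ℕ∞) ψ)
    (hψ0 : ∀ t, 0 ≤ ψ t) {a r s : ℝ} (hs : 0 ≤ s) (hsupp : Function.support ψ ⊆ closedBall a r) :
    ∃ θ : ℝ → ℝ, ContDiff ℝ (⊤ : ℕ∞) θ ∧ (∀ t, 0 ≤ θ t) ∧
      (∀ t, HasDerivAt θ (ψ t - ψ (t - s)) t) ∧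
      Function.support θ ⊆ Icc (a - r) (a + s + r) := by
  have hF : ∀ t, HasDerivAt (fun t => ∫ u in (0 : ℝ)..t, ψ u) (ψ t) t := fun t =>
    intervalIntegral.integral_hasDerivAt_right (hψ.continuous.intervalIntegrable _ _)
      (hψ.continuous.stronglyMeasurableAtFilter _ _) hψ.continuous.continuousAt
  have hint : ∀ t, (∫ u in (0 : ℝ)..t, ψ u) - ∫ u in (0 : ℝ)..(t - s), ψ u
      = ∫ u in (t - s)..t, ψ u := fun t =>
    intervalIntegral.integral_interval_sub_left (hψ.continuous.intervalIntegrable _ _)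
      (hψ.continuous.intervalIntegrable _ _)
  have hderiv : ∀ t, HasDerivAt (fun t => ∫ u in (t - s)..t, ψ u) (ψ t - ψ (t - s)) t := by
    intro t
    simp_rw [← hint]
    exact (hF t).sub ((hF (t - s)).comp_sub_const t s)
  refine ⟨fun t => ∫ u in (t - s)..t, ψ u, ?_, ?_, hderiv, ?_⟩
  · rw [contDiff_infty_iff_deriv]
    refine ⟨fun t => (hderiv t).differentiableAt, ?_⟩
    rw [show deriv (fun t => ∫ u in (t - s)..t, ψ u) = fun t => ψ t - ψ (t - s) from
      funext fun t => (hderiv t).deriv]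
    exact hψ.sub (hψ.comp (contDiff_id.sub contDiff_const))
  · exact fun t => intervalIntegral.integral_nonneg (by linarith) fun u _ => hψ0 u
  · intro t ht
    by_contra hmem
    refine ht ?_
    refine (intervalIntegral.integral_congr (g := fun _ => (0 : ℝ)) fun u hu => ?_).trans (by simp)
    by_contra hne
    have h1 := hsupp (show u ∈ Function.support ψ from hne)
    rw [Real.closedBall_eq_Icc] at h1
    rw [uIcc_of_le (by linarith)] at hu
    exact hmem ⟨by linarith [h1.1, hu.2], by linarith [h1.2, hu.1]⟩

/-- If the `t`-segment from `(a, ω₁)` to `(a + s, ω₁)` stays in `D`, then a function that decreases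
in `t` in the distributional sense, is at most `1`, and equals `1` near `(a + s, ω₁)`, equals `1`
near `(a, ω₁)`. -/
lemma ae_eq_one_near_of_segment {m : ℕ}
    {D Q : Set (ℝ × EuclideanSpace ℝ (Fin m))} (hD : IsOpen D)
    {g : ℝ × EuclideanSpace ℝ (Fin m) → ℝ} (hg_meas : Measurable g)
    (hg01 : ∀ᵐ p : ℝ × EuclideanSpace ℝ (Fin m), p ∈ D → 0 ≤ g p ∧ g p ≤ 1)
    (hmono : ∀ φ : ℝ × EuclideanSpace ℝ (Fin m) → ℝ,
      ContDiff ℝ (⊤ : ℕ∞) φ → HasCompactSupport φ → tsupport φ ⊆ D → (∀ p, 0 ≤ φ p) →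
      (0:ℝ) ≤ ∫ p in D, g p * fderiv ℝ φ p (1, 0))
    {a s : ℝ} {ω₁ : EuclideanSpace ℝ (Fin m)} (hs : 0 ≤ s)
    (hseg : Icc a (a + s) ×ˢ {ω₁} ⊆ D) (hQ : Q ∈ nhds (a + s, ω₁))
    (hg1 : ∀ᵐ p : ℝ × EuclideanSpace ℝ (Fin m), p ∈ Q → g p = 1) :
    ∃ U ∈ nhds (a, ω₁), ∀ᵐ p : ℝ × EuclideanSpace ℝ (Fin m), p ∈ U → g p = 1 := by
  obtain ⟨r₁, hr₁, hr₁D⟩ :=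
    (isCompact_Icc.prod isCompact_singleton).exists_cthickening_subset_open hD hseg
  obtain ⟨r₂, hr₂, hr₂Q⟩ := Metric.nhds_basis_closedBall.mem_iff.1 hQ
  obtain ⟨r, hr, hrr₁, hrr₂⟩ : ∃ r : ℝ, 0 < r ∧ r ≤ r₁ ∧ r ≤ r₂ :=
    ⟨min r₁ r₂, lt_min hr₁ hr₂, min_le_left _ _, min_le_right _ _⟩
  have htube : Icc (a - r) (a + s + r) ×ˢ closedBall ω₁ r ⊆ D := by
    rintro ⟨t, ω⟩ ⟨⟨ht₁, ht₂⟩, hω⟩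
    refine hr₁D (mem_cthickening_of_dist_le (t, ω) (max a (min t (a + s)), ω₁) r₁ _ ?_ ?_)
    · exact ⟨⟨le_max_left _ _, max_le (by linarith) (min_le_right _ _)⟩, rfl⟩
    · refine (max_le ?_ hω).trans hrr₁
      dsimp only at ht₁ ht₂ ⊢
      rw [Real.dist_eq, abs_le]
      rcases max_cases a (min t (a + s)) with h | h <;>
        rcases min_cases t (a + s) with h' | h' <;> constructor <;> linarith
  let ψ : ContDiffBump a := ⟨r / 2, r, by linarith, by linarith⟩
  let η : ContDiffBump ω₁ := ⟨r / 2, r, by linarith, by linarith⟩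
  have hψs : Function.support ψ ⊆ closedBall a r := by
    rw [ψ.support_eq]; exact ball_subset_closedBall
  have hηs : Function.support η ⊆ closedBall ω₁ r := by
    rw [η.support_eq]; exact ball_subset_closedBall
  obtain ⟨θ, hθ, hθ0, hθ', hθs⟩ :=
    exists_nonneg_primitive_sub_translate ψ.contDiff (fun _ => ψ.nonneg) hs hψs
  set K : Set (ℝ × EuclideanSpace ℝ (Fin m)) := Icc (a - r) (a + s + r) ×ˢ closedBall ω₁ r
    with hK
  have hKc : IsCompact K := isCompact_Icc.prod (isCompact_closedBall _ _)
  have hsupp : ∀ f : ℝ → ℝ, Function.support f ⊆ Icc (a - r) (a + s + r) →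
      Function.support (fun p : ℝ × EuclideanSpace ℝ (Fin m) => f p.1 * η p.2) ⊆ K :=
    fun f hf p hp => ⟨hf (left_ne_zero_of_mul hp), hηs (right_ne_zero_of_mul hp)⟩
  have hψK : Function.support ψ ⊆ Icc (a - r) (a + s + r) := by
    refine hψs.trans ?_
    rw [Real.closedBall_eq_Icc]
    exact Icc_subset_Icc le_rfl (by linarith)
  have hψK' : Function.support (fun t => ψ (t - s)) ⊆ Icc (a - r) (a + s + r) := by
    intro t ht
    have h := hψs (show t - s ∈ Function.support ψ from ht)
    rw [Real.closedBall_eq_Icc] at h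
    exact ⟨by linarith [h.1], by linarith [h.2]⟩
  have hη : ContDiff ℝ (⊤ : ℕ∞) η := η.contDiff
  have hψ : Continuous ψ := ψ.continuous
  have hmain := hmono (fun p => θ p.1 * η p.2)
    ((hθ.comp contDiff_fst).mul (hη.comp contDiff_snd))
    (HasCompactSupport.of_support_subset_isCompact hKc (hsupp θ hθs))
    ((closure_minimal (hsupp θ hθs) hKc.isClosed).trans htube)
    (fun p => mul_nonneg (hθ0 _) η.nonneg)
  have hfd : ∀ p : ℝ × EuclideanSpace ℝ (Fin m),
      fderiv ℝ (fun p : ℝ × EuclideanSpace ℝ (Fin m) => θ p.1 * η p.2) p (1, 0)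
        = (ψ p.1 - ψ (p.1 - s)) * η p.2 := by
    intro p
    have hd : DifferentiableAt ℝ
        (fun p : ℝ × EuclideanSpace ℝ (Fin m) => θ p.1 * η p.2) (p.1, p.2) :=
      (((hθ.comp contDiff_fst).mul (hη.comp contDiff_snd)).differentiable (by simp)) p
    have h1 := hd.hasFDerivAt.comp_hasDerivAt p.1
      ((hasDerivAt_id p.1).prodMk (hasDerivAt_const p.1 p.2))
    exact h1.unique ((hθ' p.1).mul_const (η p.2))
  simp_rw [hfd] at hmain
  have hint : ∀ f : ℝ → ℝ, Continuous f → Function.support f ⊆ Icc (a - r) (a + s + r) →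
      IntegrableOn (fun p : ℝ × EuclideanSpace ℝ (Fin m) => f p.1 * η p.2) D := by
    intro f hf hfs
    refine Integrable.integrableOn (Continuous.integrable_of_hasCompactSupport ?_
      (HasCompactSupport.of_support_subset_isCompact hKc (hsupp f hfs)))
    exact (hf.comp continuous_fst).mul (η.continuous.comp continuous_snd)
  have hgD : ∀ᵐ p ∂(volume.restrict D), 0 ≤ g p ∧ g p ≤ 1 :=
    (ae_restrict_iff' hD.measurableSet).2 hg01
  have hgint : ∀ f : ℝ → ℝ, Continuous f → Function.support f ⊆ Icc (a - r) (a + s + r) →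
      IntegrableOn (fun p : ℝ × EuclideanSpace ℝ (Fin m) => g p * (f p.1 * η p.2)) D := by
    intro f hf hfs
    refine (hint f hf hfs).bdd_mul (c := 1) hg_meas.aestronglyMeasurable ?_
    filter_upwards [hgD] with p hp
    rw [Real.norm_eq_abs, abs_le]
    exact ⟨by linarith [hp.1], hp.2⟩
  have hψ' : Continuous fun t => ψ (t - s) := hψ.comp (continuous_id.sub continuous_const)
  have hfull : ∀ f : ℝ → ℝ, Function.support f ⊆ Icc (a - r) (a + s + r) →
      ∫ p in D, f p.1 * η p.2 = (∫ t, f t) * ∫ ω, η ω := by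
    intro f hfs
    rw [setIntegral_eq_integral_of_forall_compl_eq_zero]
    · exact integral_prod_mul f η
    · intro p hp
      by_contra hne
      exact hp (htube (hsupp f hfs hne))
  have htranslate : ∫ p in D, g p * (ψ (p.1 - s) * η p.2) = ∫ p in D, ψ p.1 * η p.2 := by
    rw [hfull ψ hψK, ← integral_sub_right_eq_self ψ s, ← hfull _ hψK']
    refine integral_congr_ae (ae_restrict_of_ae ?_)
    filter_upwards [hg1] with p hp
    by_cases hne : ψ (p.1 - s) * η p.2 = 0
    · simp [hne]
    · rw [hp (hr₂Q ?_), one_mul]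
      have h1 := hψs (left_ne_zero_of_mul hne)
      have h2 := hηs (right_ne_zero_of_mul hne)
      refine (max_le ?_ h2).trans hrr₂
      rw [mem_closedBall, Real.dist_eq] at h1
      rwa [Real.dist_eq, ← sub_sub, sub_right_comm]
  have hle : ∫ p in D, (1 - g p) * (ψ p.1 * η p.2) ≤ 0 := by
    have h1 : ∫ p in D, g p * ((ψ p.1 - ψ (p.1 - s)) * η p.2)
        = (∫ p in D, g p * (ψ p.1 * η p.2)) - ∫ p in D, g p * (ψ (p.1 - s) * η p.2) := by
      rw [← integral_sub (hgint ψ hψ hψK) (hgint _ hψ' hψK')]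
      congr 1 with p
      ring
    have h2 : ∫ p in D, (1 - g p) * (ψ p.1 * η p.2)
        = (∫ p in D, ψ p.1 * η p.2) - ∫ p in D, g p * (ψ p.1 * η p.2) := by
      rw [← integral_sub (hint ψ hψ hψK) (hgint ψ hψ hψK)]
      congr 1 with p
      ring
    linarith
  have hnn : 0 ≤ᵐ[volume.restrict D] fun p => (1 - g p) * (ψ p.1 * η p.2) := by
    filter_upwards [hgD] with p hp
    exact mul_nonneg (by linarith [hp.2]) (mul_nonneg ψ.nonneg η.nonneg)
  have hzero := (setIntegral_eq_zero_iff_of_nonneg_ae hnn (by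
    refine ((hint ψ hψ hψK).sub (hgint ψ hψ hψK)).congr (Filter.Eventually.of_forall fun p => ?_)
    simp only [Pi.sub_apply]
    ring)).1 (le_antisymm hle (integral_nonneg_of_ae hnn))
  refine ⟨ball a r ×ˢ ball ω₁ r, prod_mem_nhds (ball_mem_nhds _ hr) (ball_mem_nhds _ hr), ?_⟩
  filter_upwards [(ae_restrict_iff' hD.measurableSet).1 hzero] with p hp hpU
  have h1 : ψ p.1 ≠ 0 := (ψ.pos_of_mem_ball hpU.1).ne'
  have h2 : η p.2 ≠ 0 := (η.pos_of_mem_ball hpU.2).ne'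
  have h3 := hp (htube (hsupp ψ hψK (mul_ne_zero h1 h2)))
  have h4 := (mul_eq_zero.1 h3).resolve_right (mul_ne_zero h1 h2)
  linarith

/-- Propagation of the value `1` backwards in `t` for a function `g` with
`0 ≤ g ≤ 1` and distributional `∂g/∂t ≤ 0`: if `g = 1` a.e. on the box
`Q = (t₀-ε, t₀+ε) × B_ε(ω₀) ⊆ D`, and the `t`-slices of `D` are intervals,
then `g = 1` a.e. on `C = {(t,ω) ∈ D : |ω-ω₀| < ε, t < t₀+ε}`. -/
theorem monotone_in_t_propagation
    (m : ℕ)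
    (D : Set (ℝ × EuclideanSpace ℝ (Fin m))) (hD : IsOpen D)
    (hslice : ∀ ω : EuclideanSpace ℝ (Fin m), ({t : ℝ | (t, ω) ∈ D}).OrdConnected)
    (g : ℝ × EuclideanSpace ℝ (Fin m) → ℝ) (hg_meas : Measurable g)
    (hg01 : ∀ᵐ p : ℝ × EuclideanSpace ℝ (Fin m), p ∈ D → 0 ≤ g p ∧ g p ≤ 1)
    (hmono : ∀ φ : ℝ × EuclideanSpace ℝ (Fin m) → ℝ,
      ContDiff ℝ (⊤ : ℕ∞) φ → HasCompactSupport φ → tsupport φ ⊆ D → (∀ p, 0 ≤ φ p) →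
      (0:ℝ) ≤ ∫ p in D, g p * fderiv ℝ φ p (1, 0))
    (t₀ ε : ℝ) (ω₀ : EuclideanSpace ℝ (Fin m)) (hε : 0 < ε)
    (hQ : Ioo (t₀ - ε) (t₀ + ε) ×ˢ ball ω₀ ε ⊆ D)
    (hg1 : ∀ᵐ p : ℝ × EuclideanSpace ℝ (Fin m),
      p ∈ Ioo (t₀ - ε) (t₀ + ε) ×ˢ ball ω₀ ε → g p = 1) :
    ∀ᵐ p : ℝ × EuclideanSpace ℝ (Fin m),
      (p ∈ D ∧ dist p.2 ω₀ < ε ∧ p.1 < t₀ + ε) → g p = 1 := by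
  suffices h : volume {p : ℝ × EuclideanSpace ℝ (Fin m) |
      (p ∈ D ∧ dist p.2 ω₀ < ε ∧ p.1 < t₀ + ε) ∧ g p ≠ 1} = 0 by
    rw [ae_iff]
    simpa only [Classical.not_imp] using h
  refine measure_null_of_locally_null _ fun p hp => ?_
  obtain ⟨⟨hpD, hpω, hpt⟩, -⟩ := hp
  have hQo : IsOpen (Ioo (t₀ - ε) (t₀ + ε) ×ˢ ball ω₀ ε) := isOpen_Ioo.prod isOpen_ball
  have hmem : (p.1 + (max p.1 t₀ - p.1), p.2) ∈ Ioo (t₀ - ε) (t₀ + ε) ×ˢ ball ω₀ ε := by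
    rw [add_sub_cancel]
    exact ⟨⟨(sub_lt_self _ hε).trans_le (le_max_right _ _), max_lt hpt (by linarith)⟩, hpω⟩
  obtain ⟨U, hU, hgU⟩ := ae_eq_one_near_of_segment hD hg_meas hg01 hmono (a := p.1)
    (s := max p.1 t₀ - p.1) (ω₁ := p.2) (sub_nonneg.2 (le_max_left _ _))
    (by
      rintro ⟨t, ω⟩ ⟨ht, rfl⟩
      exact (hslice _).out hpD (hQ hmem) ht)
    (hQo.mem_nhds hmem) hg1
  refine ⟨_, inter_mem_nhdsWithin _ hU, measure_mono_null ?_ (ae_iff.1 hgU)⟩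
  rintro q ⟨⟨-, hq⟩, hqU⟩ hqg
  exact hq (hqg hqU)
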